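/- There is a constant C such that for every integer D ≥ 1 there exists a 1-local proof-labeling scheme (f, A) of size at most C·log D in the anonymous setting which, on labeled k×q grid graphs with k, q ≥ 2 and diameter at most D, accepts a grid graph G if and only if G has at most one selected vertex (i.e., if and only if G satisfies AMOS). -/

import Mathlib

open SimpleGraph Filter

/-- An anonymous network configuration: a finite connected simple graph whose
vertices carry an input bit (`sel`, "selected") but no identifiers. -/
structure ANetwork where
  n : ℕ
  G : SimpleGraph (Fin n)
  conn : G.Connected
  sel : Fin n → Bool

/-- AMOS: at most one vertex is selected. -/
def ANetwork.AMOS (N : ANetwork) : Prop :=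
  ∀ u v : Fin N.n, N.sel u = true → N.sel v = true → u = v

/-- The radius-`r` ball around `v`. -/
def ANetwork.ball (N : ANetwork) (r : ℕ) (v : Fin N.n) : Set (Fin N.n) :=
  {u : Fin N.n | N.G.dist v u ≤ r}

lemma ANetwork.center_mem_ball (N : ANetwork) (r : ℕ) (v : Fin N.n) :
    v ∈ N.ball r v := by
  simp [ANetwork.ball, SimpleGraph.dist_self]

/-- A verifier: at each vertex of each network, given certificates (bit strings),
it accepts (`true`) or rejects (`false`). -/
def AVerifier : Type :=
  ∀ N : ANetwork, (Fin N.n → List Bool) → Fin N.n → Bool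

/-- `r`-locality in the anonymous setting: the decision at `v` only depends on
the radius-`r` ball around `v` (the subgraph induced by the vertices at distance
at most `r` from `v`, together with the input bits and the certificates in the
ball), and is invariant under isomorphisms of the ball preserving input bits and
certificates. -/
def IsLocalAVerifier (r : ℕ) (A : AVerifier) : Prop :=
  ∀ (N N' : ANetwork) (P : Fin N.n → List Bool) (P' : Fin N'.n → List Bool)
    (v : Fin N.n) (v' : Fin N'.n)
    (φ : (N.G.induce (N.ball r v)) ≃g (N'.G.induce (N'.ball r v'))),
    (∀ x : N.ball r v, N.sel x.1 = N'.sel (φ x).1) →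
    (∀ x : N.ball r v, P x.1 = P' (φ x).1) →
    φ ⟨v, N.center_mem_ball r v⟩ = ⟨v', N'.center_mem_ball r v'⟩ →
    A N P v = A N' P' v'

/-- An `r`-local proof-labeling scheme of size `size` for the property `Pr`
on the class of anonymous networks `Net`: a prover assigning certificates of at
most `size` bits on yes-instances (completeness), such that on no-instances
every certificate assignment is rejected at some vertex (soundness). -/
structure APLS (r : ℕ) (size : ℕ) (Net : ANetwork → Prop) (Pr : ANetwork → Prop) where
  prover : ∀ N : ANetwork, Fin N.n → List Bool
  verifier : AVerifier
  verifier_local : IsLocalAVerifier r verifier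
  prover_size : ∀ N : ANetwork, Net N → Pr N → ∀ v, (prover N v).length ≤ size
  completeness : ∀ N : ANetwork, Net N → Pr N → ∀ v, verifier N (prover N) v = true
  soundness : ∀ N : ANetwork, Net N → ¬ Pr N →
    ∀ P : Fin N.n → List Bool, ∃ v, verifier N P v = false

/-- The `k × q` grid graph: the box (Cartesian) product of a path on `k`
vertices and a path on `q` vertices. -/
def gridGraph (k q : ℕ) : SimpleGraph (Fin k × Fin q) :=
  pathGraph k □ pathGraph q

/-- `G` is a `k × q` grid graph. -/
def IsGridGraph {n : ℕ} (G : SimpleGraph (Fin n)) (k q : ℕ) : Prop :=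
  Nonempty (G ≃g gridGraph k q)

/-- The four unit steps of the integer lattice. -/
def IsUnitStep (d : ℤ × ℤ) : Prop :=
  (d.1 = 0 ∧ (d.2 = 1 ∨ d.2 = -1)) ∨ (d.2 = 0 ∧ (d.1 = 1 ∨ d.1 = -1))

/-- A closed lattice walk of length four without backtracking bounds a parallelogram. -/
lemma parallelogram_of_unitSteps {a b c d : ℤ × ℤ}
    (hab : IsUnitStep (b - a)) (hcd : IsUnitStep (d - c))
    (hac : IsUnitStep (c - a)) (hbd : IsUnitStep (d - b))
    (hbc : b ≠ c) (had : d ≠ a) : d - c = b - a := by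
  simp only [IsUnitStep, Prod.fst_sub, Prod.snd_sub, ne_eq, Prod.ext_iff] at *
  omega

/-- Two lattice steps, both perpendicular to a third one and not opposite to each other, agree. -/
lemma unitStep_straight {a b d : ℤ × ℤ} (ha : IsUnitStep a) (hb : IsUnitStep b)
    (hd : IsUnitStep d) (hab : a + b ≠ 0) (h₁ : a ≠ d) (h₂ : a ≠ -d) (h₃ : b ≠ d) (h₄ : b ≠ -d) :
    b = a := by
  obtain ⟨x, y⟩ := a
  obtain ⟨z, w⟩ := b
  obtain ⟨u, v⟩ := d
  simp only [IsUnitStep] at ha hb hd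
  rcases ha with ⟨rfl, rfl | rfl⟩ | ⟨rfl, rfl | rfl⟩ <;>
    rcases hb with ⟨rfl, rfl | rfl⟩ | ⟨rfl, rfl | rfl⟩ <;>
    rcases hd with ⟨rfl, rfl | rfl⟩ | ⟨rfl, rfl | rfl⟩ <;> simp_all

/-- A labelling of the `k × q` grid by lattice points that maps edges to unit steps and is
injective on the neighbours of each vertex. -/
structure IsLocalLatticeEmbedding (k q : ℕ) (g : ℕ → ℕ → ℤ × ℤ) : Prop where
  step_fst : ∀ i j, i + 1 < k → j < q → IsUnitStep (g (i + 1) j - g i j)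
  step_snd : ∀ i j, i < k → j + 1 < q → IsUnitStep (g i (j + 1) - g i j)
  straight_fst : ∀ i j, i + 2 < k → j < q → g (i + 2) j ≠ g i j
  straight_snd : ∀ i j, i < k → j + 2 < q → g i (j + 2) ≠ g i j
  antidiag : ∀ i j, i + 1 < k → j + 1 < q → g (i + 1) j ≠ g i (j + 1)
  diag : ∀ i j, i + 1 < k → j + 1 < q → g (i + 1) (j + 1) ≠ g i j

namespace IsLocalLatticeEmbedding

variable {k q : ℕ} {g : ℕ → ℕ → ℤ × ℤ}

lemma swap (h : IsLocalLatticeEmbedding k q g) :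
    IsLocalLatticeEmbedding q k (fun i j => g j i) where
  step_fst i j hi hj := h.step_snd j i hj hi
  step_snd i j hi hj := h.step_fst j i hj hi
  straight_fst i j hi hj := h.straight_snd j i hj hi
  straight_snd i j hi hj := h.straight_fst j i hj hi
  antidiag i j hi hj := (h.antidiag j i hj hi).symm
  diag i j hi hj := h.diag j i hj hi

lemma step_fst_succ_snd (h : IsLocalLatticeEmbedding k q g) {i j : ℕ}
    (hi : i + 1 < k) (hj : j + 1 < q) :
    g (i + 1) (j + 1) - g i (j + 1) = g (i + 1) j - g i j :=
  parallelogram_of_unitSteps (h.step_fst i j hi (by omega)) (h.step_fst i (j + 1) hi hj)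
    (h.step_snd i j (by omega) hj) (h.step_snd (i + 1) j hi hj)
    (h.antidiag i j hi hj) (h.diag i j hi hj)

lemma step_fst_succ_fst (h : IsLocalLatticeEmbedding k q g) {i : ℕ}
    (hi : i + 2 < k) (hq : 2 ≤ q) :
    g (i + 2) 0 - g (i + 1) 0 = g (i + 1) 0 - g i 0 := by
  refine unitStep_straight (d := g (i + 1) 1 - g (i + 1) 0) (h.step_fst i 0 (by omega) (by omega))
    (h.step_fst (i + 1) 0 hi (by omega)) (h.step_snd (i + 1) 0 (by omega) hq)
    ?_ ?_ ?_ ?_ ?_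
  · have h₁ := h.straight_fst i 0 hi (by omega)
    contrapose! h₁
    rwa [add_comm, sub_add_sub_cancel, sub_eq_zero] at h₁
  · have h₁ := h.antidiag i 0 (by omega) hq
    have h₂ := h.swap.step_fst_succ_snd (i := 0) (j := i) hq (by omega)
    contrapose! h₁
    simp only [zero_add] at *
    rw [h₂] at h₁
    exact sub_left_injective h₁
  · have h₁ := h.diag i 0 (by omega) hq
    contrapose! h₁
    simp only [zero_add] at *
    rw [neg_sub] at h₁
    exact (sub_right_injective h₁).symm
  · have h₁ := h.antidiag (i + 1) 0 hi hq
    contrapose! h₁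
    exact sub_left_injective h₁
  · have h₁ := h.diag (i + 1) 0 hi hq
    have h₂ := h.swap.step_fst_succ_snd (i := 0) (j := i + 1) hq hi
    contrapose! h₁
    simp only [zero_add] at *
    rw [← h₂, neg_sub] at h₁
    exact (sub_right_injective h₁).symm

lemma step_fst_eq (h : IsLocalLatticeEmbedding k q g) (hq : 2 ≤ q) {i j : ℕ}
    (hi : i + 1 < k) (hj : j < q) : g (i + 1) j - g i j = g 1 0 - g 0 0 := by
  induction j with
  | succ j ih => rw [h.step_fst_succ_snd hi hj, ih (by omega)]
  | zero =>
    induction i with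
    | zero => rfl
    | succ i ih => rw [h.step_fst_succ_fst hi hq, ih (by omega)]

lemma step_snd_eq (h : IsLocalLatticeEmbedding k q g) (hk : 2 ≤ k) {i j : ℕ}
    (hi : i < k) (hj : j + 1 < q) : g i (j + 1) - g i j = g 0 1 - g 0 0 :=
  h.swap.step_fst_eq hk hj hi

lemma eq_affine (h : IsLocalLatticeEmbedding k q g) (hk : 2 ≤ k) (hq : 2 ≤ q) {i j : ℕ}
    (hi : i < k) (hj : j < q) :
    g i j = g 0 0 + i • (g 1 0 - g 0 0) + j • (g 0 1 - g 0 0) := by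
  induction j with
  | succ j ih =>
    rw [← sub_add_cancel (g i (j + 1)) (g i j), h.step_snd_eq hk hi hj, ih (by omega), succ_nsmul]
    abel
  | zero =>
    induction i with
    | zero => simp
    | succ i ih =>
      rw [← sub_add_cancel (g (i + 1) 0) (g i 0), h.step_fst_eq hq hi hj, ih (by omega), succ_nsmul]
      simp only [zero_smul, add_zero]
      abel

/-- A locally injective lattice labelling of a grid is injective. -/
theorem injective (h : IsLocalLatticeEmbedding k q g) (hk : 2 ≤ k) (hq : 2 ≤ q) {i j i' j' : ℕ}
    (hi : i < k) (hj : j < q) (hi' : i' < k) (hj' : j' < q) (heq : g i j = g i' j') :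
    i = i' ∧ j = j' := by
  have h₁ := h.step_fst 0 0 hk (by omega)
  have h₂ := h.step_snd 0 0 (by omega) hq
  have h₃ := h.antidiag 0 0 hk hq
  have h₄ := h.diag 0 0 hk hq
  rw [h.eq_affine hk hq hi hj, h.eq_affine hk hq hi' hj'] at heq
  have h₅ := h.eq_affine hk hq (i := 1) (j := 1) hk hq
  simp only [IsUnitStep, zero_add, one_smul, Prod.fst_sub, Prod.snd_sub, Prod.fst_add, Prod.snd_add,
    ne_eq, Prod.ext_iff, Prod.smul_fst, Prod.smul_snd] at *
  simp only [nsmul_eq_mul] at heq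
  generalize (g 0 0).1 = x₀ at *
  generalize (g 0 0).2 = y₀ at *
  generalize hx₁ : (g 1 0).1 - x₀ = x₁ at *
  generalize hy₁ : (g 1 0).2 - y₀ = y₁ at *
  generalize hx₂ : (g 0 1).1 - x₀ = x₂ at *
  generalize hy₂ : (g 0 1).2 - y₀ = y₂ at *
  rcases h₁ with ⟨rfl, rfl | rfl⟩ | ⟨rfl, rfl | rfl⟩ <;>
    rcases h₂ with ⟨rfl, rfl | rfl⟩ | ⟨rfl, rfl | rfl⟩ <;> omega

end IsLocalLatticeEmbedding

/-- The local check: selected vertices lie at the origin, neighbours differ by a unit step, and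
distinct neighbours have distinct labels. -/
def LatticeCheck (N : ANetwork) (ℓ : Fin N.n → ℤ × ℤ) (v : Fin N.n) : Prop :=
  (N.sel v = true → ℓ v = 0) ∧ (∀ u, N.G.Adj v u → IsUnitStep (ℓ u - ℓ v)) ∧
    ∀ u w, N.G.Adj v u → N.G.Adj v w → ℓ u = ℓ w → u = w

lemma ANetwork.mem_ball_one_of_adj {N : ANetwork} {v u : Fin N.n} (h : N.G.Adj v u) :
    u ∈ N.ball 1 v :=
  (SimpleGraph.dist_eq_one_iff_adj.mpr h).le

/-- The lattice check is preserved by isomorphisms of radius-one balls. -/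
lemma LatticeCheck.of_iso {N N' : ANetwork} {ℓ : Fin N.n → ℤ × ℤ} {ℓ' : Fin N'.n → ℤ × ℤ}
    {v : Fin N.n} {v' : Fin N'.n}
    (φ : (N.G.induce (N.ball 1 v)) ≃g (N'.G.induce (N'.ball 1 v')))
    (hsel : ∀ x : N.ball 1 v, N.sel x.1 = N'.sel (φ x).1)
    (hℓ : ∀ x : N.ball 1 v, ℓ x.1 = ℓ' (φ x).1)
    (hφ : φ ⟨v, N.center_mem_ball 1 v⟩ = ⟨v', N'.center_mem_ball 1 v'⟩)
    (h : LatticeCheck N ℓ v) : LatticeCheck N' ℓ' v' := by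
  obtain ⟨h₁, h₂, h₃⟩ := h
  have hv : ℓ v = ℓ' v' := by simpa [hφ] using hℓ ⟨v, N.center_mem_ball 1 v⟩
  have hs : N.sel v = N'.sel v' := by simpa [hφ] using hsel ⟨v, N.center_mem_ball 1 v⟩
  have key : ∀ u', N'.G.Adj v' u' → ∃ x : N.ball 1 v,
      N.G.Adj v x.1 ∧ ℓ x.1 = ℓ' u' ∧ (φ x).1 = u' := by
    intro u' hu'
    obtain ⟨x, hx⟩ := φ.surjective ⟨u', N'.mem_ball_one_of_adj hu'⟩
    refine ⟨x, ?_, by rw [hℓ x, hx], by rw [hx]⟩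
    have := φ.map_adj_iff (v := ⟨v, N.center_mem_ball 1 v⟩) (w := x)
    rw [hφ, hx] at this
    exact this.mp hu'
  refine ⟨fun h => by rw [← hv, h₁ (hs.trans h)], fun u' hu' => ?_, fun u' w' hu' hw' he => ?_⟩
  · obtain ⟨x, hx, hxu, -⟩ := key u' hu'
    rw [← hxu, ← hv]
    exact h₂ _ hx
  · obtain ⟨x, hx, hxu, rfl⟩ := key u' hu'
    obtain ⟨y, hy, hyw, rfl⟩ := key w' hw'
    rw [Subtype.ext (h₃ _ _ hx hy (by rw [hxu, hyw, he]))]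

open Classical in
/-- The verifier performing the lattice check on decoded certificates. -/
noncomputable def latticeVerifier (dec : List Bool → ℤ × ℤ) : AVerifier :=
  fun N P v => decide (LatticeCheck N (dec ∘ P) v)

lemma latticeVerifier_local (dec : List Bool → ℤ × ℤ) :
    IsLocalAVerifier 1 (latticeVerifier dec) := by
  intro N N' P P' v v' φ hsel hP hφ
  simp only [latticeVerifier, decide_eq_decide]
  refine ⟨LatticeCheck.of_iso φ hsel (fun x => congrArg dec (hP x)) hφ,
    LatticeCheck.of_iso φ.symm (fun y => ?_) (fun y => ?_) ?_⟩
  · simpa using (hsel (φ.symm y)).symm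
  · simpa using congrArg dec (hP (φ.symm y)).symm
  · rw [← hφ]
    exact φ.symm_apply_apply _

/-- Adjacency in the grid graph, in coordinates. -/
lemma gridGraph_adj {k q : ℕ} {x y : Fin k × Fin q} :
    (gridGraph k q).Adj x y ↔
      ((x.1.val + 1 = y.1.val ∨ y.1.val + 1 = x.1.val) ∧ x.2 = y.2) ∨
      ((x.2.val + 1 = y.2.val ∨ y.2.val + 1 = x.2.val) ∧ x.1 = y.1) := by
  simp [gridGraph, SimpleGraph.boxProd_adj, SimpleGraph.pathGraph_adj]

/-- On a grid, labels passing the lattice check everywhere are injective. -/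
lemma LatticeCheck.injective {N : ANetwork} {k q : ℕ} (hk : 2 ≤ k) (hq : 2 ≤ q)
    (hG : IsGridGraph N.G k q) {ℓ : Fin N.n → ℤ × ℤ} (h : ∀ v, LatticeCheck N ℓ v) :
    Function.Injective ℓ := by
  obtain ⟨φ⟩ := hG
  have hstep : ∀ x y, (gridGraph k q).Adj x y → IsUnitStep (ℓ (φ.symm y) - ℓ (φ.symm x)) :=
    fun x y hxy => (h _).2.1 _ (φ.symm.map_adj_iff.mpr hxy)
  have hinj : ∀ x y z, (gridGraph k q).Adj x y → (gridGraph k q).Adj x z → y ≠ z →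
      ℓ (φ.symm y) ≠ ℓ (φ.symm z) := fun x y z hxy hxz hyz he =>
    hyz (φ.symm.injective
      ((h _).2.2 _ _ (φ.symm.map_adj_iff.mpr hxy) (φ.symm.map_adj_iff.mpr hxz) he))
  let g : ℕ → ℕ → ℤ × ℤ := fun i j =>
    if hij : i < k ∧ j < q then ℓ (φ.symm (⟨i, hij.1⟩, ⟨j, hij.2⟩)) else 0
  have hg : ∀ {i j : ℕ} (hi : i < k) (hj : j < q), g i j = ℓ (φ.symm (⟨i, hi⟩, ⟨j, hj⟩)) :=
    fun hi hj => dif_pos ⟨hi, hj⟩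
  have emb : IsLocalLatticeEmbedding k q g := by
    constructor <;> intro i j hi hj
    · rw [hg hi hj, hg (by omega) hj]
      exact hstep _ _ (by simp [gridGraph_adj])
    · rw [hg hi hj, hg hi (by omega)]
      exact hstep _ _ (by simp [gridGraph_adj])
    · rw [hg hi hj, hg (by omega) hj]
      exact hinj (⟨i + 1, by omega⟩, ⟨j, hj⟩) _ _ (by simp [gridGraph_adj])
        (by simp [gridGraph_adj]) (by simp)
    · rw [hg hi hj, hg hi (by omega)]
      exact hinj (⟨i, hi⟩, ⟨j + 1, by omega⟩) _ _ (by simp [gridGraph_adj])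
        (by simp [gridGraph_adj]) (by simp)
    · rw [hg hi (by omega), hg (by omega) hj]
      exact hinj (⟨i, by omega⟩, ⟨j, by omega⟩) _ _ (by simp [gridGraph_adj])
        (by simp [gridGraph_adj]) (by simp)
    · rw [hg hi hj, hg (by omega) (by omega)]
      exact hinj (⟨i + 1, hi⟩, ⟨j, by omega⟩) _ _ (by simp [gridGraph_adj])
        (by simp [gridGraph_adj]) (by simp)
  intro u v huv
  have hgφ : ∀ w, g (φ w).1 (φ w).2 = ℓ w := fun w => by
    rw [hg (φ w).1.isLt (φ w).2.isLt]
    simp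
  obtain ⟨h₁, h₂⟩ := emb.injective hk hq (φ u).1.isLt (φ u).2.isLt (φ v).1.isLt (φ v).2.isLt
    (by rw [hgφ, hgφ, huv])
  exact φ.injective (Prod.ext (Fin.ext h₁) (Fin.ext h₂))

/-- An integer function changing by at most one along edges is 1-Lipschitz for the distance. -/
lemma abs_sub_le_dist {V : Type*} {G : SimpleGraph V} (hG : G.Connected) (f : V → ℤ)
    (hf : ∀ u v, G.Adj u v → |f u - f v| ≤ 1) (u v : V) : |f u - f v| ≤ G.dist u v := by
  obtain ⟨p, hp⟩ := hG.exists_walk_length_eq_dist u v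
  rw [← hp]
  clear hp
  induction p with
  | nil => simp
  | cons h p ih =>
    rw [SimpleGraph.Walk.length_cons, Nat.cast_succ]
    have := abs_sub_le (f _) (f _) (f _) |>.trans (add_le_add (hf _ _ h) ih)
    linarith

/-- Lattice points with coordinates bounded by `D` can be encoded by `6 * log D` bits. -/
lemma exists_lattice_decoding {D : ℕ} (hD : 2 ≤ D) :
    ∃ dec : List Bool → ℤ × ℤ, ∀ p : ℤ × ℤ, |p.1| ≤ D → |p.2| ≤ D →
      ∃ l : List Bool, l.length ≤ 6 * Nat.log 2 D ∧ dec l = p := by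
  set S : Finset (ℤ × ℤ) := Finset.Icc (-D : ℤ) D ×ˢ Finset.Icc (-D : ℤ) D with hS
  have hcard : Fintype.card S ≤ Fintype.card (List.Vector Bool (6 * Nat.log 2 D)) := by
    have h₁ : D < 2 ^ (Nat.log 2 D + 1) := Nat.lt_pow_succ_log_self (by norm_num) D
    have h₂ : 1 ≤ Nat.log 2 D := Nat.log_pos (by norm_num) hD
    have h₃ : 2 ^ (Nat.log 2 D + 2) ≤ 2 ^ (3 * Nat.log 2 D) :=
      Nat.pow_le_pow_right (by norm_num) (by omega)
    have h₄ : 2 * D + 1 ≤ 2 ^ (3 * Nat.log 2 D) := by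
      rw [pow_succ] at h₁ h₃
      rw [pow_succ] at h₃
      omega
    have h₅ : ((D : ℤ) + 1 - -D).toNat = 2 * D + 1 := by omega
    rw [card_vector, Fintype.card_bool, Fintype.card_coe, hS, Finset.card_product, Int.card_Icc, h₅,
      show 6 * Nat.log 2 D = 3 * Nat.log 2 D + 3 * Nat.log 2 D by ring, pow_add]
    exact Nat.mul_le_mul h₄ h₄
  obtain ⟨e⟩ := Function.Embedding.nonempty_of_card_le hcard
  have he : Function.Injective (fun s : S => (e s).toList) :=
    fun s t hst => e.injective (List.Vector.eq _ _ hst)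
  refine ⟨Function.extend (fun s : S => (e s).toList) Subtype.val 0, fun p h₁ h₂ => ?_⟩
  have hp : p ∈ S := by
    simp only [hS, Finset.mem_product, Finset.mem_Icc]
    exact ⟨abs_le.mp h₁, abs_le.mp h₂⟩
  exact ⟨(e ⟨p, hp⟩).toList, by simp, he.extend_apply _ _ ⟨p, hp⟩⟩

section Labelling

variable {N : ANetwork} {k q : ℕ}

lemma abs_fst_sub_le_dist (φ : N.G ≃g gridGraph k q) (u v : Fin N.n) :
    |((φ u).1.val : ℤ) - (φ v).1.val| ≤ N.G.dist u v := by
  refine abs_sub_le_dist N.conn (fun w => ((φ w).1.val : ℤ)) (fun u v huv => ?_) u v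
  have := gridGraph_adj.mp (φ.map_adj_iff.mpr huv)
  simp only [Fin.ext_iff] at this
  rw [abs_le]
  omega

lemma abs_snd_sub_le_dist (φ : N.G ≃g gridGraph k q) (u v : Fin N.n) :
    |((φ u).2.val : ℤ) - (φ v).2.val| ≤ N.G.dist u v := by
  refine abs_sub_le_dist N.conn (fun w => ((φ w).2.val : ℤ)) (fun u v huv => ?_) u v
  have := gridGraph_adj.mp (φ.map_adj_iff.mpr huv)
  simp only [Fin.ext_iff] at this
  rw [abs_le]
  omega

/-- A grid with at least two rows and columns has diameter at least two. -/
lemma two_le_of_grid_dist_le (hk : 2 ≤ k) (hq : 2 ≤ q) (hG : IsGridGraph N.G k q) {D : ℕ}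
    (hD : ∀ u v : Fin N.n, N.G.dist u v ≤ D) : 2 ≤ D := by
  obtain ⟨φ⟩ := hG
  let a : Fin N.n := φ.symm (⟨0, by omega⟩, ⟨0, by omega⟩)
  let b : Fin N.n := φ.symm (⟨1, hk⟩, ⟨1, hq⟩)
  have h := abs_sub_le_dist N.conn (fun w => ((φ w).1.val : ℤ) + (φ w).2.val)
    (fun u v huv => by
      have := gridGraph_adj.mp (φ.map_adj_iff.mpr huv)
      simp only [Fin.ext_iff] at this
      rw [abs_le]
      omega) a b
  have h' := hD a b
  simp only [a, b, RelIso.apply_symm_apply, Nat.cast_zero, Nat.cast_one] at h h'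
  norm_num at h
  omega

/-- The coordinates relative to a fixed vertex `s` pass the lattice check if only `s` can be
selected. -/
lemma latticeCheck_relative (φ : N.G ≃g gridGraph k q) {s : Fin N.n}
    (hs : ∀ u, N.sel u = true → u = s) (v : Fin N.n) :
    LatticeCheck N (fun w => (((φ w).1.val : ℤ) - (φ s).1.val, ((φ w).2.val : ℤ) - (φ s).2.val))
      v := by
  refine ⟨fun hv => by simp [hs v hv], fun u hu => ?_, fun u w _ _ he => ?_⟩
  · have := gridGraph_adj.mp (φ.map_adj_iff.mpr hu)
    simp only [Fin.ext_iff] at this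
    simp only [IsUnitStep, Prod.fst_sub, Prod.snd_sub]
    omega
  · rw [Prod.mk.injEq] at he
    exact φ.injective (Prod.ext (Fin.ext (by omega)) (Fin.ext (by omega)))

end Labelling

/-- In anonymous grid graphs, AMOS (at most one selected vertex) can be
certified with `O(log D)` bits: there is a constant `C` such that for every
`D ≥ 1` there is a 1-local proof-labeling scheme of size `C · log D` certifying
AMOS on `k × q` grid graphs (`k, q ≥ 2`) of diameter at most `D`. -/
theorem amos_grid_log_diameter :
    ∃ C : ℕ, ∀ D : ℕ, 1 ≤ D →
      Nonempty (APLS 1 (C * Nat.log 2 D)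
        (fun N => (∃ k q : ℕ, 2 ≤ k ∧ 2 ≤ q ∧ IsGridGraph N.G k q) ∧
          (∀ u v : Fin N.n, N.G.dist u v ≤ D))
        ANetwork.AMOS) := by
  classical
  refine ⟨6, fun D _ => ?_⟩
  have hdec : ∃ dec : List Bool → ℤ × ℤ, 2 ≤ D → ∀ p : ℤ × ℤ, |p.1| ≤ D → |p.2| ≤ D →
      ∃ l : List Bool, l.length ≤ 6 * Nat.log 2 D ∧ dec l = p := by
    by_cases hD : 2 ≤ D
    · obtain ⟨dec, h⟩ := exists_lattice_decoding hD
      exact ⟨dec, fun _ => h⟩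
    · exact ⟨fun _ => 0, fun h => absurd h hD⟩
  obtain ⟨dec, hdec⟩ := hdec
  have hcert : ∀ N : ANetwork, ∃ P : Fin N.n → List Bool,
      ((∃ k q : ℕ, 2 ≤ k ∧ 2 ≤ q ∧ IsGridGraph N.G k q) ∧ ∀ u v : Fin N.n, N.G.dist u v ≤ D) →
      N.AMOS → ∀ v, (P v).length ≤ 6 * Nat.log 2 D ∧ LatticeCheck N (dec ∘ P) v := by
    intro N
    by_cases hN : ((∃ k q : ℕ, 2 ≤ k ∧ 2 ≤ q ∧ IsGridGraph N.G k q) ∧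
      ∀ u v : Fin N.n, N.G.dist u v ≤ D) ∧ N.AMOS
    · obtain ⟨⟨⟨k, q, hk, hq, hG⟩, hdist⟩, hA⟩ := hN
      have hD := two_le_of_grid_dist_le hk hq hG hdist
      obtain ⟨φ⟩ := hG
      obtain ⟨s, hs⟩ : ∃ s, ∀ u, N.sel u = true → u = s := by
        by_cases h : ∃ s, N.sel s = true
        · obtain ⟨s, hs⟩ := h
          exact ⟨s, fun u hu => hA u s hu hs⟩
        · exact ⟨N.conn.nonempty.some, fun u hu => absurd ⟨u, hu⟩ h⟩
      choose P hlen hP using fun v : Fin N.n =>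
        hdec hD (((φ v).1.val : ℤ) - (φ s).1.val, ((φ v).2.val : ℤ) - (φ s).2.val)
          ((abs_fst_sub_le_dist φ v s).trans (by exact_mod_cast hdist v s))
          ((abs_snd_sub_le_dist φ v s).trans (by exact_mod_cast hdist v s))
      refine ⟨P, fun _ _ v => ⟨hlen v, ?_⟩⟩
      rw [show dec ∘ P = _ from funext hP]
      exact latticeCheck_relative φ hs v
    · exact ⟨fun _ => [], fun h₁ h₂ => absurd ⟨h₁, h₂⟩ hN⟩
  choose prover hprover using hcert
  refine ⟨⟨prover, latticeVerifier dec, latticeVerifier_local dec,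
    fun N h₁ h₂ v => (hprover N h₁ h₂ v).1,
    fun N h₁ h₂ v => decide_eq_true (hprover N h₁ h₂ v).2, fun N hN hA P => ?_⟩⟩
  obtain ⟨⟨k, q, hk, hq, hG⟩, -⟩ := hN
  by_contra! hacc
  have hcheck : ∀ v, LatticeCheck N (dec ∘ P) v := fun v =>
    of_decide_eq_true (Bool.not_eq_false _ ▸ hacc v)
  refine hA fun u v hu hv => LatticeCheck.injective hk hq hG hcheck ?_
  rw [(hcheck u).1 hu, (hcheck v).1 hv]
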